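/- arXiv:2012.04213 — 8 statements merged into one kernel-verified Lean document; each statement's English description precedes it below -/
import Mathlib

section
/- Let L be any N×N real matrix and Δ ∈ ℝ. Define the 2N×2N block matrix M = [[I_N, Δ·L], [−Δ·I_N, (1−Δ)·I_N − Δ·L]]. Then for every complex number μ, det(μ·I_{2N} − M) = (μ − (1−Δ))^N · det((μ − 1)·I_N + Δ·L). Consequently, the complex eigenvalues of M, counted with multiplicity, are 1 − Δ (with multiplicity N) together with 1 − Δ·λ for each complex eigenvalue λ of L. -/
open Matrix

/-- Adding the first block row to the second and subtracting the second block column from the first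
triangularizes `[[a, -B], [d, a + d + B]]`. -/
theorem det_fromBlocks_smul_one_add {n R : Type*} [Fintype n] [DecidableEq n] [CommRing R]
    (a d : R) (B : Matrix n n R) :
    (fromBlocks (a • (1 : Matrix n n R)) (-B) (d • (1 : Matrix n n R))
      ((a + d) • (1 : Matrix n n R) + B)).det =
      (a + d) ^ Fintype.card n * (a • (1 : Matrix n n R) + B).det := by
  have h : fromBlocks (1 : Matrix n n R) 0 1 1 *
      fromBlocks (a • (1 : Matrix n n R)) (-B) (d • (1 : Matrix n n R))
        ((a + d) • (1 : Matrix n n R) + B) * fromBlocks (1 : Matrix n n R) 0 (-1) 1 =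
      fromBlocks (a • (1 : Matrix n n R) + B) (-B) 0 ((a + d) • (1 : Matrix n n R)) := by
    simp only [fromBlocks_multiply]
    congr 1 <;> simp [add_smul]
  have hdet := congrArg det h
  simp only [det_mul, det_fromBlocks_zero₁₂, det_fromBlocks_zero₂₁, det_one, one_mul, mul_one,
    det_smul] at hdet
  rw [hdet, mul_comm]

theorem det_smul_one_add_smul_eq_prod_roots {n K : Type*} [Fintype n] [DecidableEq n] [Field K]
    [IsAlgClosed K] (A : Matrix n n K) (a d : K) :
    (a • (1 : Matrix n n K) + d • A).det =
      (A.charpoly.roots.map fun r => a + d * r).prod := by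
  have hs := IsAlgClosed.splits A.charpoly
  have hcard : A.charpoly.roots.card = Fintype.card n := by
    rw [← hs.natDegree_eq_card_roots, charpoly_natDegree_eq_dim]
  rcases eq_or_ne d 0 with rfl | hd
  · simp [hcard]
  · have h : a • (1 : Matrix n n K) + d • A = (-d) • (scalar n (-a / d) - A) := by
      rw [scalar_apply, ← smul_one_eq_diagonal, smul_sub, smul_smul,
        show -d * (-a / d) = a by field_simp, neg_smul, sub_neg_eq_add]
    rw [h, det_smul, ← eval_charpoly, hs.eval_eq_prod_roots_of_monic A.charpoly_monic, ← hcard,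
      ← Multiset.prod_replicate, ← Multiset.map_const', ← Multiset.prod_map_mul]
    congr 1
    refine Multiset.map_congr rfl fun r _ => ?_
    field_simp
    ring

/-- For the block matrix `M = [[I, ΔL], [−ΔI, (1−Δ)I − ΔL]]`:
`det(μI − M) = (μ − (1−Δ))^N · det((μ−1)I + ΔL)` for all `μ : ℂ`; consequently
the complex eigenvalues of `M` with multiplicity are `1 − Δ` (multiplicity `N`)
together with `1 − Δλ` for each complex eigenvalue `λ` of `L`. -/
theorem stmt2 (N : ℕ) (L : Matrix (Fin N) (Fin N) ℝ) (Δ : ℝ)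
    (M : Matrix (Fin N ⊕ Fin N) (Fin N ⊕ Fin N) ℝ)
    (hM : M = Matrix.fromBlocks 1 (Δ • L) (-(Δ • (1 : Matrix (Fin N) (Fin N) ℝ)))
      ((1 - Δ) • (1 : Matrix (Fin N) (Fin N) ℝ) - Δ • L)) :
    (∀ μ : ℂ,
      (μ • (1 : Matrix (Fin N ⊕ Fin N) (Fin N ⊕ Fin N) ℂ) - M.map Complex.ofReal).det =
        (μ - ((1 : ℂ) - (Δ : ℂ))) ^ N *
          ((μ - 1) • (1 : Matrix (Fin N) (Fin N) ℂ) + (Δ : ℂ) • L.map Complex.ofReal).det) ∧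
    (M.map Complex.ofReal).charpoly.roots =
      Multiset.replicate N ((1 : ℂ) - (Δ : ℂ)) +
        (L.map Complex.ofReal).charpoly.roots.map (fun lam => 1 - (Δ : ℂ) * lam) := by
  have hdet (μ : ℂ) :
      (μ • (1 : Matrix (Fin N ⊕ Fin N) (Fin N ⊕ Fin N) ℂ) - M.map Complex.ofReal).det =
        (μ - ((1 : ℂ) - (Δ : ℂ))) ^ N *
          ((μ - 1) • (1 : Matrix (Fin N) (Fin N) ℂ) + (Δ : ℂ) • L.map Complex.ofReal).det := by
    have h := det_fromBlocks_smul_one_add (μ - 1) (Δ : ℂ) ((Δ : ℂ) • L.map Complex.ofReal)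
    rw [Fintype.card_fin, show μ - 1 + (Δ : ℂ) = μ - (1 - (Δ : ℂ)) by ring] at h
    rw [← h, hM]
    congr 1
    ext (i | i) (j | j) <;> by_cases hij : i = j <;>
      simp [hij, one_apply] <;> ring
  refine ⟨hdet, ?_⟩
  rw [← Polynomial.roots_multiset_prod_X_sub_C (Multiset.replicate N ((1 : ℂ) - (Δ : ℂ)) +
    (L.map Complex.ofReal).charpoly.roots.map (fun lam => 1 - (Δ : ℂ) * lam))]
  congr 1
  refine Polynomial.funext fun μ => ?_
  rw [eval_charpoly, scalar_apply, ← smul_one_eq_diagonal, hdet,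
    det_smul_one_add_smul_eq_prod_roots, Polynomial.eval_multiset_prod]
  simp only [Multiset.map_add, Multiset.map_map, Multiset.prod_add, Multiset.map_replicate,
    Multiset.prod_replicate, Function.comp_def, Polynomial.eval_sub, Polynomial.eval_X,
    Polynomial.eval_C, sub_sub_eq_add_sub, sub_add_eq_add_sub]
end

section
/- Consider N agents running algorithm (2) over a weight-balanced weighted digraph with stepsize Δ ∈ ℝ and initialization Σ_{i=1}^N v^i(0) = 0. Then for every k ∈ ℕ, (1/N)·Σ_{i=1}^N x^i(k) − r^avg = (1−Δ)^k · ((1/N)·Σ_{i=1}^N x^i(0) − r^avg). In particular, if Δ ∈ (0,2) the arithmetic mean of the agreement states converges geometrically to r^avg. -/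
/-- Over a weight-balanced digraph the Laplacian has zero column sums. -/
theorem sum_sum_mul_sub_eq_zero_of_balanced {ι R : Type*} [Fintype ι] [CommRing R]
    (a : ι → ι → R) (hbal : ∀ i, ∑ j, a i j = ∑ j, a j i) (y : ι → R) :
    ∑ i, ∑ j, a i j * (y i - y j) = 0 := by
  simp only [mul_sub, Finset.sum_sub_distrib]
  rw [Finset.sum_comm (f := fun i j => a i j * y j)]
  simp only [← Finset.sum_mul, hbal, sub_self]

/-- Mean dynamics of algorithm (2): with `Σ v^i(0) = 0` over a weight-balanced
digraph, the deviation of the mean of the agreement states from `r^avg` decays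
as `(1−Δ)^k`; in particular, for `Δ ∈ (0,2)` the mean converges to `r^avg`. -/
theorem stmt4 (N : ℕ) (hN : 0 < N) (a : Fin N → Fin N → ℝ) (Δ : ℝ)
    (r : Fin N → ℝ) (v x : ℕ → Fin N → ℝ)
    (ha_nonneg : ∀ i j, 0 ≤ a i j) (ha_diag : ∀ i, a i i = 0)
    (hbal : ∀ i, ∑ j, a i j = ∑ j, a j i)
    (hv0 : ∑ i, v 0 i = 0)
    (hv : ∀ k i, v (k + 1) i = v k i + Δ * ∑ j, a i j * (x k i - x k j))
    (hx : ∀ k i, x (k + 1) i =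
      x k i + Δ * (-(x k i - r i) - (∑ j, a i j * (x k i - x k j)) - v k i)) :
    (∀ k, (1 / (N : ℝ)) * ∑ i, x k i - (1 / (N : ℝ)) * ∑ i, r i =
      (1 - Δ) ^ k * ((1 / (N : ℝ)) * ∑ i, x 0 i - (1 / (N : ℝ)) * ∑ i, r i)) ∧
    (0 < Δ → Δ < 2 →
      Filter.Tendsto (fun k => (1 / (N : ℝ)) * ∑ i, x k i) Filter.atTop
        (nhds ((1 / (N : ℝ)) * ∑ i, r i))) := by
  have hL k := sum_sum_mul_sub_eq_zero_of_balanced a hbal (x k)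
  have hvk : ∀ k, ∑ i, v k i = 0 := by
    intro k
    induction k with
    | zero => exact hv0
    | succ k ih => simp only [hv, Finset.sum_add_distrib, ← Finset.mul_sum, ih, hL, mul_zero,
        add_zero]
  have hstep k : ∑ i, x (k + 1) i = ∑ i, x k i - Δ * (∑ i, x k i - ∑ i, r i) := by
    simp only [hx, Finset.sum_add_distrib, ← Finset.mul_sum, Finset.sum_sub_distrib,
      Finset.sum_neg_distrib, hL, hvk]
    ring
  have hmean : ∀ k, (1 / (N : ℝ)) * ∑ i, x k i - (1 / (N : ℝ)) * ∑ i, r i =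
      (1 - Δ) ^ k * ((1 / (N : ℝ)) * ∑ i, x 0 i - (1 / (N : ℝ)) * ∑ i, r i) := by
    intro k
    induction k with
    | zero => simp
    | succ k ih =>
      rw [hstep, pow_succ]
      linear_combination (1 - Δ) * ih
  refine ⟨hmean, fun h0 h2 => tendsto_sub_nhds_zero_iff.mp ?_⟩
  refine (Filter.tendsto_congr hmean).mpr ?_
  have habs : |1 - Δ| < 1 := abs_lt.mpr ⟨by linarith, by linarith⟩
  simpa using (tendsto_pow_atTop_nhds_zero_of_abs_lt_one habs).mul_const
    ((1 / (N : ℝ)) * ∑ i, x 0 i - (1 / (N : ℝ)) * ∑ i, r i)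
end

section
/- (Indistinguishability construction underlying Lemma 1.) Fix an agent t and suppose the adjacency matrix A = [a_ij] satisfies a_ii = 0 for all i and is balanced at node t, i.e., d := Σ_j a_tj = Σ_i a_it. Let ε ∈ ℝ and Δ ∈ ℝ be arbitrary. Consider two executions of algorithm (2): execution 1 with references {r₁^i} and initial conditions v₁^i(0) = 0, x₁^i(0); execution 2 with references r₂^t = r₁^t − d·ε, r₂^i = r₁^i + a_it·ε for i ≠ t, and initial conditions v₂^i(0) = 0, x₂^i(0) = x₁^i(0) for i ≠ t, x₂^t(0) = x₁^t(0) − ε. Then for every k ∈ ℕ: (a) x₁^i(k) = x₂^i(k) for every agent i ≠ t; (b) x₁^t(k) − x₂^t(k) = (1−Δ)^k·ε; and (c) Σ_{i=1}^N r₂^i = Σ_{i=1}^N r₁^i. In particular, if |1−Δ| < 1 the two executions produce identical transmitted signals at every agent other than t while the reference value of agent t differs by d·ε, which can be made arbitrarily large. -/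
/-- The Laplacian terms of two states that agree away from `t` differ, at a node `i ≠ t`, by the
weight of the edge from `i` to `t` times the difference at `t`. -/
theorem sum_mul_sub_sub_of_ne {ι : Type*} [Fintype ι] (a : ι → ι → ℝ) {i t : ι} (x y : ι → ℝ)
    (h : ∀ j, j ≠ t → x j = y j) (hi : i ≠ t) :
    ∑ j, a i j * (x i - x j) - ∑ j, a i j * (y i - y j) = -(a i t * (x t - y t)) := by
  rw [← Finset.sum_sub_distrib, Finset.sum_eq_single t]
  · rw [h i hi]; ring
  · intro j _ hj
    rw [h i hi, h j hj]; ring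
  · simp

/-- The Laplacian terms of two states that agree away from `t` differ, at `t` itself, by the
out-degree of `t` times the difference at `t`. -/
theorem sum_mul_sub_sub_self {ι : Type*} [Fintype ι] (a : ι → ι → ℝ) {t : ι} (x y : ι → ℝ)
    (h : ∀ j, j ≠ t → x j = y j) (ht : a t t = 0) :
    ∑ j, a t j * (x t - x j) - ∑ j, a t j * (y t - y j) = (∑ j, a t j) * (x t - y t) := by
  rw [← Finset.sum_sub_distrib, Finset.sum_mul]
  refine Finset.sum_congr rfl fun j _ => ?_
  by_cases hj : j = t
  · simp [hj, ht]
  · rw [h j hj]; ring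

/-- Indistinguishability construction underlying Lemma 1: two executions of
algorithm (2) whose references differ as prescribed around agent `t` produce
identical agreement trajectories at every agent other than `t`, the
trajectories of agent `t` differ by `(1−Δ)^k·ε`, and the reference sums agree. -/
theorem stmt6 (N : ℕ) (a : Fin N → Fin N → ℝ) (t : Fin N) (ε Δ : ℝ)
    (ha_diag : ∀ i, a i i = 0)
    (hbal : ∑ j, a t j = ∑ j, a j t)
    (r1 r2 : Fin N → ℝ) (v1 x1 v2 x2 : ℕ → Fin N → ℝ)
    (hv1 : ∀ k i, v1 (k + 1) i = v1 k i + Δ * ∑ j, a i j * (x1 k i - x1 k j))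
    (hx1 : ∀ k i, x1 (k + 1) i =
      x1 k i + Δ * (-(x1 k i - r1 i) - (∑ j, a i j * (x1 k i - x1 k j)) - v1 k i))
    (hv2 : ∀ k i, v2 (k + 1) i = v2 k i + Δ * ∑ j, a i j * (x2 k i - x2 k j))
    (hx2 : ∀ k i, x2 (k + 1) i =
      x2 k i + Δ * (-(x2 k i - r2 i) - (∑ j, a i j * (x2 k i - x2 k j)) - v2 k i))
    (hr2t : r2 t = r1 t - (∑ j, a t j) * ε)
    (hr2 : ∀ i, i ≠ t → r2 i = r1 i + a i t * ε)
    (hv10 : ∀ i, v1 0 i = 0) (hv20 : ∀ i, v2 0 i = 0)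
    (hx20 : ∀ i, i ≠ t → x2 0 i = x1 0 i)
    (hx20t : x2 0 t = x1 0 t - ε) :
    (∀ k, ∀ i, i ≠ t → x1 k i = x2 k i) ∧
    (∀ k, x1 k t - x2 k t = (1 - Δ) ^ k * ε) ∧
    (∑ i, r2 i = ∑ i, r1 i) := by
  have key : ∀ k, (∀ i, i ≠ t → x1 k i = x2 k i) ∧ x1 k t - x2 k t = (1 - Δ) ^ k * ε ∧
      (∀ i, i ≠ t → v1 k i - v2 k i = a i t * ((1 - Δ) ^ k * ε - ε)) ∧
      v1 k t - v2 k t = (∑ j, a t j) * (ε - (1 - Δ) ^ k * ε) := by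
    intro k
    induction k with
    | zero =>
      refine ⟨fun i hi => (hx20 i hi).symm, by rw [hx20t]; ring, fun i _ => ?_, ?_⟩
      · rw [hv10, hv20]; ring
      · rw [hv10, hv20]; ring
    | succ k ih =>
      obtain ⟨hx, hxt, hv, hvt⟩ := ih
      have hLt := sum_mul_sub_sub_self a (x1 k) (x2 k) hx (ha_diag t)
      have hL := fun i (hi : i ≠ t) => sum_mul_sub_sub_of_ne a (x1 k) (x2 k) hx hi
      rw [hxt] at hLt
      simp only [hxt] at hL
      refine ⟨fun i hi => ?_, ?_, fun i hi => ?_, ?_⟩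
      · rw [hx1, hx2, hr2 i hi]
        linear_combination (1 - Δ) * hx i hi - Δ * hL i hi - Δ * hv i hi
      · rw [hx1, hx2, hr2t]
        linear_combination (1 - Δ) * hxt - Δ * hLt - Δ * hvt
      · rw [hv1, hv2]
        linear_combination hv i hi + Δ * hL i hi
      · rw [hv1, hv2]
        linear_combination hvt + Δ * hLt
  refine ⟨fun k => (key k).1, fun k => (key k).2.1, ?_⟩
  have hr : ∀ i, r2 i = r1 i + a i t * ε - if i = t then (∑ j, a t j) * ε else 0 := by
    intro i
    by_cases hi : i = t
    · subst hi
      simp [hr2t, ha_diag]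
    · simp [hi, hr2 i hi]
  simp only [hr, Finset.sum_sub_distrib, Finset.sum_add_distrib, Finset.sum_ite_eq',
    Finset.mem_univ, if_true, ← Finset.sum_mul, hbal]
  ring
end

section
/- (Reference reconstruction underlying Lemma 2.) Consider N agents running algorithm (2) with stepsize Δ ≠ 0 and initialization v^i(0) = 0 for all i. Then for every agent o and every k ∈ ℕ, the reference value r^o is determined by the agreement-state trajectories of agent o and of its out-neighbors via the identity r^o = (x^o(k+1) − x^o(k))/Δ + x^o(k) + Σ_j a_oj·(x^o(k) − x^j(k)) + Δ·Σ_{m=0}^{k−1} Σ_j a_oj·(x^o(m) − x^j(m)). -/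
/-- Reference reconstruction underlying Lemma 2: with `v^i(0) = 0` and `Δ ≠ 0`,
the reference value `r^o` is determined from the agreement-state trajectories of
agent `o` and its out-neighbors. -/
theorem stmt7 (N : ℕ) (a : Fin N → Fin N → ℝ) (Δ : ℝ) (hΔ : Δ ≠ 0)
    (r : Fin N → ℝ) (v x : ℕ → Fin N → ℝ)
    (hv0 : ∀ i, v 0 i = 0)
    (hv : ∀ k i, v (k + 1) i = v k i + Δ * ∑ j, a i j * (x k i - x k j))
    (hx : ∀ k i, x (k + 1) i =
      x k i + Δ * (-(x k i - r i) - (∑ j, a i j * (x k i - x k j)) - v k i)) :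
    ∀ (o : Fin N) (k : ℕ),
      r o = (x (k + 1) o - x k o) / Δ + x k o + (∑ j, a o j * (x k o - x k j)) +
        Δ * ∑ m ∈ Finset.range k, ∑ j, a o j * (x m o - x m j) := by
  intro o k
  have v_eq : v k o = Δ * ∑ m ∈ Finset.range k, ∑ j, a o j * (x m o - x m j) := by
    induction k with
    | zero => simp [hv0]
    | succ k ih => rw [hv, ih, Finset.sum_range_succ, mul_add]
  rw [← v_eq, hx, add_sub_cancel_left, mul_div_cancel_left₀ _ hΔ]
  ring
end

section
/- (Observer error dynamics in the proof of Theorem 3.) Let agent i run the perturbed algorithm (12) driven by arbitrary out-neighbor signals x^j(·), with stepsize Δ ∈ ℝ. Let the observer states satisfy v̂(0) = v^i(0), and the updates v̂(k+1) = v̂(k) + Δ·Σ_j a_ij·(x^i(k) − x^j(k)) and x̂(k+1) = x̂(k) + Δ·(Σ_j a_ij·(x^i(k) − x^j(k)) + v̂(k) − x̂(k)). Then v̂(k) = v^i(k) for all k, and the signal ẑ(k) := x̂(k) + x^i(k) satisfies ẑ(k+1) = (1−Δ)·ẑ(k) + Δ·(r^i + f^i(k)) for all k ∈ ℕ. -/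
/-- Observer error dynamics in the proof of Theorem 3: with `v̂(0) = v^i(0)` the
observer auxiliary state tracks `v^i` exactly, and `ẑ(k) = x̂(k) + x^i(k)`
satisfies `ẑ(k+1) = (1−Δ)ẑ(k) + Δ(r^i + f^i(k))`. -/
theorem stmt12 (N : ℕ) (a : Fin N → Fin N → ℝ) (i : Fin N) (Δ : ℝ)
    (r : ℝ) (f : ℕ → ℝ) (x : ℕ → Fin N → ℝ) (v vh xh : ℕ → ℝ)
    (hvi : ∀ k, v (k + 1) = v k + Δ * ∑ j, a i j * (x k i - x k j))
    (hxi : ∀ k, x (k + 1) i =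
      x k i + Δ * (-(x k i - r) - (∑ j, a i j * (x k i - x k j)) - v k + f k))
    (hvh0 : vh 0 = v 0)
    (hvh : ∀ k, vh (k + 1) = vh k + Δ * ∑ j, a i j * (x k i - x k j))
    (hxh : ∀ k, xh (k + 1) =
      xh k + Δ * ((∑ j, a i j * (x k i - x k j)) + vh k - xh k)) :
    (∀ k, vh k = v k) ∧
    (∀ k, xh (k + 1) + x (k + 1) i = (1 - Δ) * (xh k + x k i) + Δ * (r + f k)) := by
  have h : ∀ k, vh k = v k := by
    intro k
    induction k with
    | zero => exact hvh0
    | succ k ih => rw [hvh, hvi, ih]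
  refine ⟨h, fun k => ?_⟩
  rw [hxh, hxi, h]
  ring
end

section
/- Let Δ ∈ (0,2), r ∈ ℝ, and let f : ℕ → ℝ satisfy lim_{k→∞} Σ_{m=0}^{k} (1−Δ)^{k−m}·f(m) = 0. If z : ℕ → ℝ satisfies z(k+1) = (1−Δ)·z(k) + Δ·(r + f(k)) for all k ∈ ℕ, then z(k) → r as k → ∞. -/
/-- Discrete convolution with a geometric sequence satisfies a first-order linear recursion. -/
theorem sum_range_pow_sub_mul_succ {R : Type*} [CommSemiring R] (a : R) (f : ℕ → R) (k : ℕ) :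
    ∑ m ∈ Finset.range (k + 1 + 1), a ^ (k + 1 - m) * f m =
      a * ∑ m ∈ Finset.range (k + 1), a ^ (k - m) * f m + f (k + 1) := by
  rw [Finset.sum_range_succ, Nat.sub_self, pow_zero, one_mul, Finset.mul_sum]
  congr 1
  refine Finset.sum_congr rfl fun m hm => ?_
  rw [Nat.sub_add_comm (Finset.mem_range_succ_iff.mp hm), pow_succ', mul_assoc]

/-- Variation of constants for the relaxation `z (k + 1) = (1 - Δ) * z k + Δ * (r + f k)`. -/
theorem relaxation_succ_eq {R : Type*} [CommRing R] {Δ r : R} {f z : ℕ → R}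
    (hrec : ∀ k, z (k + 1) = (1 - Δ) * z k + Δ * (r + f k)) (k : ℕ) :
    z (k + 1) = r + (1 - Δ) ^ (k + 1) * (z 0 - r) +
      Δ * ∑ m ∈ Finset.range (k + 1), (1 - Δ) ^ (k - m) * f m := by
  induction k with
  | zero => simp [hrec 0]; ring
  | succ k ih => rw [hrec, ih, sum_range_pow_sub_mul_succ]; ring

/-- Convergence core of Theorem 3: if `Δ ∈ (0,2)`, the perturbation satisfies
the admissibility condition `Σ_{m=0}^{k} (1−Δ)^{k−m} f(m) → 0`, and
`z(k+1) = (1−Δ)z(k) + Δ(r + f(k))`, then `z(k) → r`. -/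
theorem stmt13 (Δ : ℝ) (hΔ0 : 0 < Δ) (hΔ2 : Δ < 2) (r : ℝ) (f z : ℕ → ℝ)
    (hf : Filter.Tendsto (fun k => ∑ m ∈ Finset.range (k + 1), (1 - Δ) ^ (k - m) * f m)
      Filter.atTop (nhds 0))
    (hrec : ∀ k, z (k + 1) = (1 - Δ) * z k + Δ * (r + f k)) :
    Filter.Tendsto z Filter.atTop (nhds r) := by
  rw [← Filter.tendsto_add_atTop_iff_nat 1]
  have hpow : Filter.Tendsto (fun k : ℕ => (1 - Δ) ^ (k + 1)) Filter.atTop (nhds 0) :=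
    (Filter.tendsto_add_atTop_iff_nat 1).mpr <|
      tendsto_pow_atTop_nhds_zero_of_abs_lt_one (abs_lt.mpr ⟨by linarith, by linarith⟩)
  simpa [relaxation_succ_eq hrec] using
    ((hpow.mul_const (z 0 - r)).const_add r).add (hf.const_mul Δ)
end

section
/- (Theorem 3: perturbation signals do not increase privacy.) Let agent i run the perturbed algorithm (12) driven by arbitrary out-neighbor signals x^j(·), with stepsize Δ ∈ (0,2), initialization v^i(0) = 0, and a perturbation signal f^i satisfying lim_{k→∞} Σ_{m=0}^{k} (1−Δ)^{k−m}·f^i(m) = 0. Define the observer v̂(0) = x̂(0) = 0, v̂(k+1) = v̂(k) + Δ·Σ_j a_ij·(x^i(k) − x^j(k)), x̂(k+1) = x̂(k) + Δ·(Σ_j a_ij·(x^i(k) − x^j(k)) + v̂(k) − x̂(k)), and ẑ(k) = x̂(k) + x^i(k). Then ẑ(k) → r^i as k → ∞. -/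
/-- Variation of constants for a scalar affine recurrence. -/
theorem affine_recurrence_eq_sum {R : Type*} [CommRing R] {e f : ℕ → R} {q c : R}
    (h : ∀ k, e (k + 1) = q * e k + c * f k) (k : ℕ) :
    e (k + 1) = q ^ (k + 1) * e 0 + c * ∑ m ∈ Finset.range (k + 1), q ^ (k - m) * f m := by
  induction k with
  | zero => simp [h]
  | succ k ih =>
    have hs : ∑ m ∈ Finset.range (k + 1), q ^ (k + 1 - m) * f m =
        q * ∑ m ∈ Finset.range (k + 1), q ^ (k - m) * f m := by
      rw [Finset.mul_sum]
      refine Finset.sum_congr rfl fun m hm => ?_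
      rw [Nat.succ_sub (Nat.lt_succ_iff.mp (Finset.mem_range.mp hm)), pow_succ]
      ring
    rw [h, ih, Finset.sum_range_succ _ (k + 1), hs, Nat.sub_self]
    ring

/-- Theorem 3 (perturbation signals do not increase privacy): for an agent `i`
running the perturbed algorithm (12) with `Δ ∈ (0,2)`, `v^i(0) = 0` and an
admissible perturbation signal, the malicious agent's observer output
`ẑ(k) = x̂(k) + x^i(k)` converges to the private reference value `r^i`. -/
theorem stmt14 (N : ℕ) (a : Fin N → Fin N → ℝ) (i : Fin N) (Δ : ℝ)
    (hΔ0 : 0 < Δ) (hΔ2 : Δ < 2)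
    (r : ℝ) (f : ℕ → ℝ) (x : ℕ → Fin N → ℝ) (v vh xh : ℕ → ℝ)
    (hv0 : v 0 = 0)
    (hvi : ∀ k, v (k + 1) = v k + Δ * ∑ j, a i j * (x k i - x k j))
    (hxi : ∀ k, x (k + 1) i =
      x k i + Δ * (-(x k i - r) - (∑ j, a i j * (x k i - x k j)) - v k + f k))
    (hf : Filter.Tendsto (fun k => ∑ m ∈ Finset.range (k + 1), (1 - Δ) ^ (k - m) * f m)
      Filter.atTop (nhds 0))
    (hvh0 : vh 0 = 0) (hxh0 : xh 0 = 0)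
    (hvh : ∀ k, vh (k + 1) = vh k + Δ * ∑ j, a i j * (x k i - x k j))
    (hxh : ∀ k, xh (k + 1) =
      xh k + Δ * ((∑ j, a i j * (x k i - x k j)) + vh k - xh k)) :
    Filter.Tendsto (fun k => xh k + x k i) Filter.atTop (nhds r) := by
  have hv : ∀ k, vh k = v k := by
    intro k
    induction k with
    | zero => rw [hvh0, hv0]
    | succ k ih => rw [hvh, hvi, ih]
  have he : ∀ k, xh (k + 1) + x (k + 1) i - r =
      (1 - Δ) * (xh k + x k i - r) + Δ * f k := by
    intro k
    rw [hxh, hxi, hv]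
    ring
  have hpow : Filter.Tendsto (fun k : ℕ => (1 - Δ) ^ (k + 1)) Filter.atTop (nhds 0) :=
    (Filter.tendsto_add_atTop_iff_nat 1).mpr <|
      tendsto_pow_atTop_nhds_zero_of_abs_lt_one (abs_lt.mpr ⟨by linarith, by linarith⟩)
  refine (Filter.tendsto_add_atTop_iff_nat 1).mp ?_
  have hlim := ((hpow.mul_const (xh 0 + x 0 i - r)).add (hf.const_mul Δ)).add_const r
  rw [zero_mul, mul_zero, add_zero, zero_add] at hlim
  refine hlim.congr fun k => ?_
  have := affine_recurrence_eq_sum (e := fun k => xh k + x k i - r) he k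
  linarith
end

section
/- (Mean dynamics of the initialization-free algorithm (4) of Remark 1.) Consider N agents running algorithm (4) over a weighted graph with symmetric adjacency matrix (a_ij = a_ji for all i, j), with stepsize Δ ∈ ℝ and arbitrary initial conditions x^i(0), v^i(0) ∈ ℝ. Then for every k ∈ ℕ, (1/N)·Σ_{i=1}^N x^i(k) − r^avg = (1−Δ)^k·((1/N)·Σ_{i=1}^N x^i(0) − r^avg); in particular, for Δ ∈ (0,2) the arithmetic mean of the agreement states converges to r^avg regardless of the initialization of v. -/
/-- Diffusive coupling terms over a symmetric weight matrix sum to zero. -/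
theorem sum_sum_symm_mul_sub_eq_zero {ι R : Type*} [Fintype ι] [CommRing R] {a : ι → ι → R}
    (hsym : ∀ i j, a i j = a j i) (y : ι → R) :
    ∑ i, ∑ j, a i j * (y i - y j) = 0 := by
  have h : ∑ i, ∑ j, a i j * y j = ∑ i, ∑ j, a i j * y i := by
    rw [Finset.sum_comm]
    exact Finset.sum_congr rfl fun i _ => Finset.sum_congr rfl fun j _ => by rw [hsym]
  simp only [mul_sub, Finset.sum_sub_distrib, h, sub_self]

/-- Mean dynamics of the initialization-free algorithm (4) of Remark 1 over an
undirected graph: for arbitrary initial conditions the deviation of the mean of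
the agreement states from `r^avg` decays as `(1−Δ)^k`; in particular, for
`Δ ∈ (0,2)` the mean converges to `r^avg` regardless of the initialization. -/
theorem stmt15 (N : ℕ) (hN : 0 < N) (a : Fin N → Fin N → ℝ) (Δ : ℝ)
    (r : Fin N → ℝ) (v x : ℕ → Fin N → ℝ)
    (ha_nonneg : ∀ i j, 0 ≤ a i j) (ha_diag : ∀ i, a i i = 0)
    (hsym : ∀ i j, a i j = a j i)
    (hv : ∀ k i, v (k + 1) i = v k i - Δ * ∑ j, a i j * (x k i - x k j))
    (hx : ∀ k i, x (k + 1) i =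
      x k i + Δ * (-(x k i - r i) - (∑ j, a i j * (x k i - x k j)) +
        ∑ j, a i j * (v k i - v k j))) :
    (∀ k, (1 / (N : ℝ)) * ∑ i, x k i - (1 / (N : ℝ)) * ∑ i, r i =
      (1 - Δ) ^ k * ((1 / (N : ℝ)) * ∑ i, x 0 i - (1 / (N : ℝ)) * ∑ i, r i)) ∧
    (0 < Δ → Δ < 2 →
      Filter.Tendsto (fun k => (1 / (N : ℝ)) * ∑ i, x k i) Filter.atTop
        (nhds ((1 / (N : ℝ)) * ∑ i, r i))) := by
  have hstep : ∀ k, ∑ i, x (k + 1) i - ∑ i, r i = (1 - Δ) * (∑ i, x k i - ∑ i, r i) := by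
    intro k
    simp only [hx, Finset.sum_add_distrib, ← Finset.mul_sum, Finset.sum_sub_distrib,
      Finset.sum_neg_distrib, sum_sum_symm_mul_sub_eq_zero hsym]
    ring
  have hmean : ∀ k, (1 / (N : ℝ)) * ∑ i, x k i - (1 / (N : ℝ)) * ∑ i, r i =
      (1 - Δ) ^ k * ((1 / (N : ℝ)) * ∑ i, x 0 i - (1 / (N : ℝ)) * ∑ i, r i) := by
    intro k
    induction k with
    | zero => simp
    | succ k ih =>
      rw [← mul_sub, hstep, mul_left_comm, mul_sub (1 / (N : ℝ)), ih, pow_succ]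
      ring
  refine ⟨hmean, fun h0 h2 => ?_⟩
  have hpow : Filter.Tendsto (fun k : ℕ => (1 - Δ) ^ k) Filter.atTop (nhds 0) :=
    tendsto_pow_atTop_nhds_zero_of_abs_lt_one (abs_lt.2 ⟨by linarith, by linarith⟩)
  rw [← tendsto_sub_nhds_zero_iff]
  refine Filter.Tendsto.congr (fun k => (hmean k).symm) ?_
  simpa using hpow.mul_const _
end
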